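/- For every positive integer k, the number of limiting vacillating tableaux of length 2k equals ∑_{j=1}^{k} S(k,j)·I(j), where I(j) is the number of involutions in the symmetric group on j letters. -/

import Mathlib

/-- A limiting vacillating tableau of length `2k`: a sequence of Young diagrams
`(λ⁽⁰⁾, λ⁽¹ᐟ²⁾, λ⁽¹⁾, ..., λ⁽ᵏ⁾)` where `lam j` is `λ⁽ʲ⁾` for integers `j` and
`mu j` is `λ⁽ʲ⁺¹ᐟ²⁾`, such that `λ⁽⁰⁾ = ∅`, each half step does nothing or deletes
one box, and each full step adds exactly one box. -/
structure LimitingVacillatingTableau (k : ℕ) where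
  lam : Fin (k + 1) → YoungDiagram
  mu : Fin k → YoungDiagram
  init : lam 0 = ⊥
  half_step : ∀ j : Fin k,
    mu j = lam j.castSucc ∨
      (mu j ≤ lam j.castSucc ∧ (lam j.castSucc).card = (mu j).card + 1)
  full_step : ∀ j : Fin k,
    mu j ≤ lam j.succ ∧ (lam j.succ).card = (mu j).card + 1

/-- `stirling k j` is the Stirling number of the second kind: the number of set
partitions of `{1, ..., k}` into exactly `j` nonempty blocks. -/
noncomputable def stirling (k j : ℕ) : ℕ :=
  Nat.card {P : Finpartition (Finset.Icc 1 k) // P.parts.card = j}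

/-- `numInvolutions j` is the number of involutions in the symmetric group on `j` letters. -/
noncomputable def numInvolutions (j : ℕ) : ℕ :=
  Nat.card {σ : Equiv.Perm (Fin j) // σ * σ = 1}

namespace YoungDiagram

open Classical in
/-- The cells that can be added to a Young diagram. -/
noncomputable def addable (l : YoungDiagram) : Finset (ℕ × ℕ) :=
  (Finset.range (l.colLen 0 + 1)).image (fun i => (i, l.rowLen i)) |>.filter
    fun c => IsLowerSet (insert c (l.cells : Set (ℕ × ℕ)))

open Classical in
/-- The cells that can be removed from a Young diagram. -/
noncomputable def removable (l : YoungDiagram) : Finset (ℕ × ℕ) :=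
  l.cells.filter fun c => IsLowerSet ((l.cells : Set (ℕ × ℕ)) \ {c})

lemma isLowerSet_iff {s : Set (ℕ × ℕ)} :
    IsLowerSet s ↔ ∀ i j i' j', i' ≤ i → j' ≤ j → (i, j) ∈ s → (i', j') ∈ s :=
  ⟨fun h _ _ _ _ hi hj hs => h (Prod.mk_le_mk.2 ⟨hi, hj⟩) hs,
    fun h _ _ hab hs => h _ _ _ _ hab.1 hab.2 hs⟩

lemma rowLen_eq_zero_iff (l : YoungDiagram) (i : ℕ) : l.rowLen i = 0 ↔ l.colLen 0 ≤ i := by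
  rw [← not_lt, ← mem_iff_lt_colLen, mem_iff_lt_rowLen]
  omega

lemma mem_addable_iff_isLowerSet {l : YoungDiagram} {c : ℕ × ℕ} :
    c ∈ l.addable ↔ c ∉ l.cells ∧ IsLowerSet (insert c (l.cells : Set (ℕ × ℕ))) := by
  obtain ⟨i, j⟩ := c
  simp only [addable, Finset.mem_filter, Finset.mem_image, Finset.mem_range, Prod.mk.injEq,
    mem_cells, mem_iff_lt_rowLen]
  refine and_congr_left fun h => ⟨?_, fun hj => ?_⟩
  · rintro ⟨i, -, rfl, rfl⟩
    exact lt_irrefl _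
  have key : ∀ i' j', i' ≤ i → j' ≤ j → (i', j') ≠ (i, j) → j' < l.rowLen i' := by
    intro i' j' hi' hj' hne
    have := isLowerSet_iff.1 h i j i' j' hi' hj' (Set.mem_insert _ _)
    simpa [hne, mem_iff_lt_rowLen] using this
  refine ⟨i, ?_, rfl, ?_⟩
  · rcases Nat.eq_zero_or_pos i with rfl | hi
    · omega
    have h1 := key (i - 1) j (by omega) le_rfl (by simp; omega)
    have h2 := l.rowLen_eq_zero_iff (i - 1)
    omega
  · rcases Nat.eq_zero_or_pos j with rfl | h0
    · omega
    have h1 := key i (j - 1) le_rfl (by omega) (by simp; omega)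
    omega

lemma mem_removable_iff_isLowerSet {l : YoungDiagram} {c : ℕ × ℕ} :
    c ∈ l.removable ↔ c ∈ l.cells ∧ IsLowerSet ((l.cells : Set (ℕ × ℕ)) \ {c}) := by
  simp [removable]

lemma mk_mem_addable {l : YoungDiagram} {i j : ℕ} :
    (i, j) ∈ l.addable ↔ j = l.rowLen i ∧ (i = 0 ∨ l.rowLen i < l.rowLen (i - 1)) := by
  rw [mem_addable_iff_isLowerSet, isLowerSet_iff]
  simp only [Set.mem_insert_iff, Prod.mk.injEq, Finset.mem_coe, mem_cells, mem_iff_lt_rowLen]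
  constructor
  · rintro ⟨hj, h⟩
    have h1 := h i j (i - 1) j (by omega) le_rfl (by simp)
    have h2 := h i j i (j - 1) le_rfl (by omega) (by simp)
    omega
  · rintro ⟨rfl, h⟩
    refine ⟨lt_irrefl _, ?_⟩
    rintro a b a' b' ha hb (⟨rfl, rfl⟩ | hab)
    · rcases ha.eq_or_lt with rfl | ha
      · omega
      · have := l.rowLen_anti a' (a - 1) (by omega)
        omega
    · have := l.rowLen_anti a' a ha
      omega

lemma mk_mem_removable {l : YoungDiagram} {i j : ℕ} :
    (i, j) ∈ l.removable ↔ j + 1 = l.rowLen i ∧ l.rowLen (i + 1) < l.rowLen i := by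
  rw [mem_removable_iff_isLowerSet, isLowerSet_iff]
  simp only [Set.mem_sdiff, Set.mem_singleton_iff, Prod.mk.injEq, Finset.mem_coe, mem_cells,
    mem_iff_lt_rowLen]
  constructor
  · rintro ⟨hj, h⟩
    have h1 := h (i + 1) j i j (by omega) le_rfl
    have h2 := h i (j + 1) i j le_rfl (by omega)
    omega
  · rintro ⟨hj, h⟩
    refine ⟨by omega, ?_⟩
    rintro a b a' b' ha hb ⟨hab, hne⟩
    have := l.rowLen_anti a' a ha
    refine ⟨by omega, ?_⟩
    rintro ⟨rfl, rfl⟩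
    rcases ha.eq_or_lt with rfl | ha
    · omega
    · have := l.rowLen_anti (a' + 1) a ha
      omega

lemma card_addable (l : YoungDiagram) : l.addable.card = l.removable.card + 1 := by
  have h0 : (0, l.rowLen 0) ∈ l.addable := mk_mem_addable.2 ⟨rfl, Or.inl rfl⟩
  rw [← Finset.card_erase_add_one h0, Nat.add_right_cancel_iff]
  refine Finset.card_nbij' (fun c => (c.1 - 1, l.rowLen (c.1 - 1) - 1))
    (fun c => (c.1 + 1, l.rowLen (c.1 + 1))) ?_ ?_ ?_ ?_
  · rintro ⟨i, j⟩ h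
    simp only [Finset.coe_erase, Set.mem_sdiff, Finset.mem_coe, mk_mem_addable,
      Set.mem_singleton_iff, Prod.mk.injEq, mk_mem_removable] at h ⊢
    obtain ⟨⟨rfl, h⟩, hne⟩ := h
    have : i ≠ 0 := by rintro rfl; simp at hne
    rw [Nat.sub_add_cancel (show 1 ≤ i by omega)]
    omega
  · rintro ⟨i, j⟩ h
    simp only [Finset.coe_erase, Set.mem_sdiff, Finset.mem_coe, mk_mem_addable,
      Set.mem_singleton_iff, Prod.mk.injEq, mk_mem_removable, Nat.add_sub_cancel, true_and] at h ⊢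
    omega
  · rintro ⟨i, j⟩ h
    simp only [Finset.coe_erase, Set.mem_sdiff, Finset.mem_coe, mk_mem_addable,
      Set.mem_singleton_iff, Prod.mk.injEq] at h ⊢
    obtain ⟨⟨rfl, h⟩, hne⟩ := h
    have : i ≠ 0 := by rintro rfl; simp at hne
    rw [Nat.sub_add_cancel (show 1 ≤ i by omega)]
    simp
  · rintro ⟨i, j⟩ h
    simp only [Finset.mem_coe, mk_mem_removable, Prod.mk.injEq, Nat.add_sub_cancel,
      true_and] at h ⊢
    rw [← h.1, Nat.add_sub_cancel]

/-- The diagrams obtained from `l` by adding one cell. -/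
noncomputable def up (l : YoungDiagram) : Finset YoungDiagram :=
  l.addable.attach.map
    ⟨fun c => ⟨insert c.1 l.cells, by
      simpa using (mem_addable_iff_isLowerSet.1 c.2).2⟩, by
      rintro ⟨a, ha⟩ ⟨b, hb⟩ h
      have h := congrArg cells h
      rw [mem_addable_iff_isLowerSet] at ha hb
      exact Subtype.ext ((Finset.insert_inj ha.1).1 h)⟩

/-- The diagrams obtained from `l` by deleting one cell. -/
noncomputable def down (l : YoungDiagram) : Finset YoungDiagram :=
  l.removable.attach.map
    ⟨fun c => ⟨l.cells.erase c.1, by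
      simpa using (mem_removable_iff_isLowerSet.1 c.2).2⟩, by
      rintro ⟨a, ha⟩ ⟨b, hb⟩ h
      have h := congrArg cells h
      rw [mem_removable_iff_isLowerSet] at ha hb
      exact Subtype.ext (Finset.erase_injOn _ ha.1 hb.1 h)⟩

lemma card_up (l : YoungDiagram) : l.up.card = l.down.card + 1 := by
  simp [up, down, card_addable]

lemma mem_up {l m : YoungDiagram} : m ∈ l.up ↔ l ≤ m ∧ m.card = l.card + 1 := by
  simp only [up, Finset.mem_map, Finset.mem_attach, true_and,
    Subtype.exists, ← cells_subset_iff]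
  constructor
  · rintro ⟨c, hc, rfl⟩
    exact ⟨Finset.subset_insert _ _,
      Finset.card_insert_of_notMem (mem_addable_iff_isLowerSet.1 hc).1⟩
  · rintro ⟨hsub, hcard⟩
    obtain ⟨c, hc, h⟩ := Finset.exists_eq_insert_iff.2 ⟨hsub, hcard.symm⟩
    refine ⟨c, mem_addable_iff_isLowerSet.2 ⟨hc, ?_⟩, YoungDiagram.ext h⟩
    rw [← Finset.coe_insert, h]
    exact m.isLowerSet

lemma mem_down {l m : YoungDiagram} : m ∈ l.down ↔ m ≤ l ∧ l.card = m.card + 1 := by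
  simp only [down, Finset.mem_map, Finset.mem_attach, true_and,
    Subtype.exists, ← cells_subset_iff]
  constructor
  · rintro ⟨c, hc, rfl⟩
    exact ⟨Finset.erase_subset _ _,
      (Finset.card_erase_add_one (mem_removable_iff_isLowerSet.1 hc).1).symm⟩
  · rintro ⟨hsub, hcard⟩
    obtain ⟨c, hc, h⟩ := Finset.exists_eq_insert_iff.2 ⟨hsub, hcard.symm⟩
    have he : l.cells.erase c = m.cells := by rw [← h, Finset.erase_insert hc]
    refine ⟨c, mem_removable_iff_isLowerSet.2 ⟨h ▸ Finset.mem_insert_self _ _, ?_⟩,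
      YoungDiagram.ext he⟩
    rw [← Finset.coe_erase, he]
    exact m.isLowerSet

lemma mem_up_iff_mem_down {l m : YoungDiagram} : m ∈ l.up ↔ l ∈ m.down := by
  rw [mem_up, mem_down]

lemma eq_of_le_of_card_le {l m : YoungDiagram} (h : l ≤ m) (hc : m.card ≤ l.card) : l = m :=
  YoungDiagram.ext (Finset.eq_of_subset_of_card_le (cells_subset_iff.2 h) hc)

lemma card_sup_add_card_inf (l m : YoungDiagram) :
    (l ⊔ m).card + (l ⊓ m).card = l.card + m.card := by
  simpa [YoungDiagram.card] using Finset.card_union_add_card_inter l.cells m.cells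

lemma sup_eq_of_mem_down {k l m : YoungDiagram} (hl : l ∈ k.down) (hm : m ∈ k.down)
    (hne : m ≠ l) : l ⊔ m = k := by
  rw [mem_down] at hl hm
  refine eq_of_le_of_card_le (sup_le hl.1 hm.1) ?_
  by_contra! h
  have h1 := eq_of_le_of_card_le (le_sup_left : l ≤ l ⊔ m) (by omega)
  exact hne (eq_of_le_of_card_le (h1 ▸ le_sup_right) (by omega))

lemma inf_eq_of_mem_up {k l m : YoungDiagram} (hl : l ∈ k.up) (hm : m ∈ k.up)
    (hne : m ≠ l) : l ⊓ m = k := by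
  rw [mem_up] at hl hm
  refine (eq_of_le_of_card_le (le_inf hl.1 hm.1) ?_).symm
  by_contra! h
  have h1 := eq_of_le_of_card_le (inf_le_left : l ⊓ m ≤ l) (by omega)
  exact hne (eq_of_le_of_card_le (h1 ▸ inf_le_right) (by omega)).symm

lemma inf_mem_down_of_mem_down {k l m : YoungDiagram} (hl : l ∈ k.down) (hm : m ∈ k.down)
    (hne : m ≠ l) : l ⊓ m ∈ l.down := by
  have h := card_sup_add_card_inf l m
  rw [sup_eq_of_mem_down hl hm hne] at h
  rw [mem_down] at *
  exact ⟨inf_le_left, by omega⟩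

lemma sup_mem_up_of_mem_up {k l m : YoungDiagram} (hl : l ∈ k.up) (hm : m ∈ k.up)
    (hne : m ≠ l) : l ⊔ m ∈ l.up := by
  have h := card_sup_add_card_inf l m
  rw [inf_eq_of_mem_up hl hm hne] at h
  rw [mem_up] at *
  exact ⟨le_sup_left, by omega⟩

/-- The operator summing a function over the diagrams obtained by adding one cell. -/
noncomputable def upSum : Module.End ℕ (YoungDiagram → ℕ) where
  toFun f l := ∑ m ∈ l.up, f m
  map_add' _ _ := by ext; simp [Finset.sum_add_distrib]
  map_smul' _ _ := by ext; simp [Finset.mul_sum]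

/-- The operator summing a function over the diagrams obtained by deleting one cell. -/
noncomputable def downSum : Module.End ℕ (YoungDiagram → ℕ) where
  toFun f l := ∑ m ∈ l.down, f m
  map_add' _ _ := by ext; simp [Finset.sum_add_distrib]
  map_smul' _ _ := by ext; simp [Finset.mul_sum]

lemma upSum_apply (f : YoungDiagram → ℕ) (l : YoungDiagram) : upSum f l = ∑ m ∈ l.up, f m := rfl

lemma downSum_apply (f : YoungDiagram → ℕ) (l : YoungDiagram) :
    downSum f l = ∑ m ∈ l.down, f m := rfl

/-- Young's lattice is a `1`-differential poset. -/
lemma upSum_mul_downSum : upSum * downSum = downSum * upSum + 1 := by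
  classical
  ext1 f
  ext l
  have hup : upSum (downSum f) l
      = ∑ k ∈ l.up, ∑ m ∈ k.down.erase l, f m + l.up.card * f l := by
    simp only [upSum_apply, downSum_apply]
    rw [← smul_eq_mul, ← Finset.sum_const, ← Finset.sum_add_distrib]
    exact Finset.sum_congr rfl fun k hk =>
      (Finset.sum_erase_add _ _ (mem_up_iff_mem_down.1 hk)).symm
  have hdown : downSum (upSum f) l
      = ∑ k ∈ l.down, ∑ m ∈ k.up.erase l, f m + l.down.card * f l := by
    simp only [upSum_apply, downSum_apply]
    rw [← smul_eq_mul, ← Finset.sum_const, ← Finset.sum_add_distrib]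
    exact Finset.sum_congr rfl fun k hk =>
      (Finset.sum_erase_add _ _ (mem_up_iff_mem_down.2 hk)).symm
  have hswap : ∑ k ∈ l.up, ∑ m ∈ k.down.erase l, f m
      = ∑ k ∈ l.down, ∑ m ∈ k.up.erase l, f m := by
    rw [Finset.sum_sigma', Finset.sum_sigma']
    refine Finset.sum_nbij' (fun x => ⟨l ⊓ x.2, x.2⟩) (fun x => ⟨l ⊔ x.2, x.2⟩) ?_ ?_ ?_ ?_ ?_
    · rintro ⟨k, m⟩ h
      simp only [Finset.mem_sigma, Finset.mem_erase] at h ⊢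
      obtain ⟨hk, hne, hm⟩ := h
      rw [mem_up_iff_mem_down] at *
      refine ⟨inf_mem_down_of_mem_down hk hm hne, hne, ?_⟩
      rw [inf_comm]
      exact inf_mem_down_of_mem_down hm hk hne.symm
    · rintro ⟨k, m⟩ h
      simp only [Finset.mem_sigma, Finset.mem_erase] at h ⊢
      obtain ⟨hk, hne, hm⟩ := h
      rw [← mem_up_iff_mem_down] at *
      refine ⟨sup_mem_up_of_mem_up hk hm hne, hne, ?_⟩
      rw [sup_comm]
      exact sup_mem_up_of_mem_up hm hk hne.symm
    · rintro ⟨k, m⟩ h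
      simp only [Finset.mem_sigma, Finset.mem_erase] at h
      rw [sup_eq_of_mem_down (mem_up_iff_mem_down.1 h.1) h.2.2 h.2.1]
    · rintro ⟨k, m⟩ h
      simp only [Finset.mem_sigma, Finset.mem_erase] at h
      rw [inf_eq_of_mem_up (mem_up_iff_mem_down.2 h.1) h.2.2 h.2.1]
    · exact fun _ _ => rfl
  simp only [Module.End.mul_apply, LinearMap.add_apply, Module.End.one_apply, Pi.add_apply]
  rw [hup, hdown, hswap, card_up]
  ring

lemma upSum_pow_succ_mul_downSum (n : ℕ) :
    upSum ^ (n + 1) * downSum = downSum * upSum ^ (n + 1) + (n + 1) • upSum ^ n := by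
  induction n with
  | zero => simpa using upSum_mul_downSum
  | succ n ih =>
    rw [pow_succ' _ (n + 1), mul_assoc, ih, mul_add, ← mul_assoc, upSum_mul_downSum, add_mul,
      mul_smul_comm, ← pow_succ', one_mul, mul_assoc, ← pow_succ', add_assoc, ← succ_nsmul']

lemma downSum_bot (f : YoungDiagram → ℕ) : downSum f ⊥ = 0 := by
  rw [downSum_apply]
  refine Finset.sum_eq_zero fun m hm => ?_
  simpa [YoungDiagram.card] using (mem_down.1 hm).2

lemma upSum_pow_downSum_upSum_bot (n : ℕ) (f : YoungDiagram → ℕ) :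
    (upSum ^ n) (downSum (upSum f)) ⊥ = n * (upSum ^ n) f ⊥ := by
  cases n with
  | zero => simp [downSum_bot]
  | succ n =>
    have h := congrFun (LinearMap.congr_fun (upSum_pow_succ_mul_downSum n) (upSum f)) ⊥
    simp only [Module.End.mul_apply, LinearMap.add_apply, Pi.add_apply, downSum_bot,
      LinearMap.smul_apply, Pi.smul_apply, smul_eq_mul, zero_add] at h
    rw [h, pow_succ, Module.End.mul_apply]

lemma upSum_one : upSum 1 = downSum 1 + 1 := by
  ext l
  simp [upSum_apply, downSum_apply, card_up]

lemma upSum_pow_one_bot_add_two (n : ℕ) :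
    (upSum ^ (n + 2)) 1 ⊥ = (upSum ^ (n + 1)) 1 ⊥ + (n + 1) * (upSum ^ n) 1 ⊥ := by
  have h := congrFun (LinearMap.congr_fun (upSum_pow_succ_mul_downSum n) 1) ⊥
  simp only [Module.End.mul_apply, LinearMap.add_apply, Pi.add_apply, downSum_bot,
    LinearMap.smul_apply, Pi.smul_apply, smul_eq_mul, zero_add] at h
  rw [pow_succ _ (n + 1), Module.End.mul_apply, upSum_one, map_add, Pi.add_apply, h, add_comm]

end YoungDiagram

namespace Finpartition

variable {α : Type*} [DecidableEq α] {s : Finset α} {a : α}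

lemma notMem_of_mem_insert_empty (ha : a ∉ s) (P : Finpartition s) {p : Finset α}
    (hp : p ∈ insert ∅ P.parts) : a ∉ p := by
  rcases Finset.mem_insert.1 hp with rfl | hp
  · simp
  · exact fun h => ha (P.subset hp h)

/-- Adjoin a new element to the (possibly empty) part `p`. -/
def adjoin (ha : a ∉ s) (P : Finpartition s) (p : Finset α) (hp : p ∈ insert ∅ P.parts) :
    Finpartition (insert a s) :=
  ofExistsUnique (insert (insert a p) (P.parts.erase p))
    (by
      have hps : p ⊆ s := by
        rcases Finset.mem_insert.1 hp with rfl | hp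
        · simp
        · exact P.subset hp
      intro q hq
      rcases Finset.mem_insert.1 hq with rfl | hq
      · exact Finset.insert_subset_insert _ hps
      · exact (P.subset (Finset.mem_of_mem_erase hq)).trans (Finset.subset_insert _ _))
    (by
      intro x hx
      have hap := notMem_of_mem_insert_empty ha P hp
      rcases Finset.mem_insert.1 hx with rfl | hx
      · refine ⟨insert x p, ⟨Finset.mem_insert_self _ _, Finset.mem_insert_self _ _⟩, ?_⟩
        rintro q ⟨hq, hxq⟩
        rcases Finset.mem_insert.1 hq with rfl | hq
        · rfl
        · exact absurd (P.subset (Finset.mem_of_mem_erase hq) hxq) ha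
      · have hxa : x ≠ a := fun h => ha (h ▸ hx)
        by_cases hxp : x ∈ p
        · refine ⟨insert a p, ⟨Finset.mem_insert_self _ _, Finset.mem_insert_of_mem hxp⟩, ?_⟩
          rintro q ⟨hq, hxq⟩
          rcases Finset.mem_insert.1 hq with rfl | hq
          · rfl
          · rcases Finset.mem_insert.1 hp with rfl | hp
            · simp at hxp
            · obtain ⟨hne, hq⟩ := Finset.mem_erase.1 hq
              exact absurd (P.eq_of_mem_parts hq hp hxq hxp) hne
        · obtain ⟨t, ht, hxt⟩ := P.exists_mem hx
          refine ⟨t, ⟨Finset.mem_insert_of_mem (Finset.mem_erase.2 ⟨?_, ht⟩), hxt⟩, ?_⟩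
          · rintro rfl
            exact hxp hxt
          · rintro q ⟨hq, hxq⟩
            rcases Finset.mem_insert.1 hq with rfl | hq
            · simp [hxa, hxp] at hxq
            · exact P.eq_of_mem_parts (Finset.mem_of_mem_erase hq) ht hxq hxt)
    (by
      intro h
      rcases Finset.mem_insert.1 h with h | h
      · exact (Finset.insert_ne_empty _ _) h.symm
      · exact P.empty_notMem_parts (Finset.mem_of_mem_erase h))

lemma parts_adjoin (ha : a ∉ s) (P : Finpartition s) (p : Finset α)
    (hp : p ∈ insert ∅ P.parts) :
    (P.adjoin ha p hp).parts = insert (insert a p) (P.parts.erase p) := rfl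

lemma insert_notMem_parts (ha : a ∉ s) (P : Finpartition s) (p : Finset α) :
    insert a p ∉ P.parts :=
  fun h => ha (P.subset h (Finset.mem_insert_self _ _))

lemma card_parts_adjoin (ha : a ∉ s) (P : Finpartition s) (p : Finset α)
    (hp : p ∈ insert ∅ P.parts) :
    (P.adjoin ha p hp).parts.card = (P.parts.erase p).card + 1 :=
  Finset.card_insert_of_notMem fun h =>
    insert_notMem_parts ha P p (Finset.mem_of_mem_erase h)

lemma part_adjoin_erase (ha : a ∉ s) (P : Finpartition s) (p : Finset α)
    (hp : p ∈ insert ∅ P.parts) : ((P.adjoin ha p hp).part a).erase a = p := by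
  rw [part_eq_of_mem _ (t := insert a p) (by simp [parts_adjoin]) (Finset.mem_insert_self _ _),
    Finset.erase_insert (notMem_of_mem_insert_empty ha P hp)]

/-- Delete an element from a partition. -/
def deleteElem (ha : a ∉ s) (Q : Finpartition (insert a s)) : Finpartition s :=
  (Q.avoid {a}).copy (by rw [Finset.insert_sdiff_of_mem _ (Finset.mem_singleton_self a),
    Finset.sdiff_singleton_eq_erase, Finset.erase_eq_of_notMem ha])

lemma parts_deleteElem (ha : a ∉ s) (Q : Finpartition (insert a s)) :
    (Q.deleteElem ha).parts
      = (insert ((Q.part a).erase a) (Q.parts.erase (Q.part a))).erase ∅ := by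
  have hA : Q.part a ∈ Q.parts := Q.part_mem.2 (Finset.mem_insert_self _ _)
  have haA : a ∈ Q.part a := Q.mem_part_self.2 (Finset.mem_insert_self _ _)
  have hB : ∀ t ∈ Q.parts, t ≠ Q.part a → t \ {a} = t := fun t ht hne =>
    Finset.sdiff_eq_self_of_disjoint
      (Finset.disjoint_singleton_right.2 fun h => hne (Q.part_eq_of_mem ht h).symm)
  ext t
  simp only [deleteElem, copy, mem_avoid, Finset.mem_erase, Finset.mem_insert]
  constructor
  · rintro ⟨d, hd, hda, rfl⟩
    refine ⟨fun h => hda (Finset.sdiff_eq_empty_iff_subset.1 h), ?_⟩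
    by_cases hdA : d = Q.part a
    · left
      rw [hdA, Finset.sdiff_singleton_eq_erase]
    · right
      rw [hB d hd hdA]
      exact ⟨hdA, hd⟩
  · rintro ⟨hne, rfl | ⟨htA, ht⟩⟩
    · refine ⟨Q.part a, hA, fun h => hne ?_, Finset.sdiff_singleton_eq_erase _ _⟩
      rw [← Finset.sdiff_singleton_eq_erase]
      exact Finset.sdiff_eq_empty_iff_subset.2 h
    · refine ⟨t, ht, fun h => hne ?_, hB t ht htA⟩
      rw [← hB t ht htA]
      exact Finset.sdiff_eq_empty_iff_subset.2 h

lemma part_erase_mem_deleteElem (ha : a ∉ s) (Q : Finpartition (insert a s)) :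
    (Q.part a).erase a ∈ insert ∅ (Q.deleteElem ha).parts := by
  rw [parts_deleteElem]
  simp only [Finset.mem_insert, Finset.mem_erase]
  tauto

lemma deleteElem_adjoin (ha : a ∉ s) (P : Finpartition s) (p : Finset α)
    (hp : p ∈ insert ∅ P.parts) : (P.adjoin ha p hp).deleteElem ha = P := by
  have hA : (P.adjoin ha p hp).part a = insert a p :=
    part_eq_of_mem _ (by simp [parts_adjoin]) (Finset.mem_insert_self _ _)
  ext1
  rw [parts_deleteElem, part_adjoin_erase, hA, parts_adjoin, Finset.erase_insert fun h =>
    insert_notMem_parts ha P p (Finset.mem_of_mem_erase h)]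
  have := P.empty_notMem_parts
  rcases Finset.mem_insert.1 hp with rfl | hp
  · rw [Finset.erase_eq_of_notMem this, Finset.erase_insert this]
  · rw [Finset.insert_erase hp, Finset.erase_eq_of_notMem this]

lemma adjoin_deleteElem (ha : a ∉ s) (Q : Finpartition (insert a s)) :
    (Q.deleteElem ha).adjoin ha ((Q.part a).erase a) (part_erase_mem_deleteElem ha Q) = Q := by
  have hA : Q.part a ∈ Q.parts := Q.part_mem.2 (Finset.mem_insert_self _ _)
  have haA : a ∈ Q.part a := Q.mem_part_self.2 (Finset.mem_insert_self _ _)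
  have hp : (Q.part a).erase a ∉ Q.parts := by
    intro h
    obtain ⟨x, hx⟩ := Q.nonempty_of_mem_parts h
    have h' := Q.eq_of_mem_parts h hA hx (Finset.mem_of_mem_erase hx)
    exact Finset.notMem_erase a (Q.part a) (by rwa [h'])
  ext1
  rw [parts_adjoin, parts_deleteElem, Finset.insert_erase haA, Finset.erase_right_comm,
    Finset.erase_insert fun h => hp (Finset.mem_of_mem_erase h),
    Finset.erase_eq_of_notMem fun h => Q.empty_notMem_parts (Finset.mem_of_mem_erase h),
    Finset.insert_erase hA]

/-- The partitions of `insert a s` arise from those of `s` by adjoining `a` either as a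
singleton or to one of the parts. -/
lemma sum_card_parts_insert (ha : a ∉ s) (g : ℕ → ℕ) :
    ∑ Q : Finpartition (insert a s), g Q.parts.card
      = ∑ P : Finpartition s, (g (P.parts.card + 1) + P.parts.card * g P.parts.card) := by
  have h (P : Finpartition s) : g (P.parts.card + 1) + P.parts.card * g P.parts.card
      = ∑ p ∈ insert ∅ P.parts, g ((P.parts.erase p).card + 1) := by
    rw [Finset.sum_insert P.empty_notMem_parts, Finset.erase_eq_of_notMem P.empty_notMem_parts,
      Finset.sum_congr rfl fun p hp => by rw [Finset.card_erase_add_one hp], Finset.sum_const,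
      smul_eq_mul]
  simp_rw [h]
  rw [Finset.sum_sigma']
  refine Finset.sum_bij' (fun Q _ => ⟨Q.deleteElem ha, (Q.part a).erase a⟩)
    (fun x hx => x.1.adjoin ha x.2 (Finset.mem_sigma.1 hx).2) ?_ ?_ ?_ ?_ ?_
  · exact fun Q _ => Finset.mem_sigma.2 ⟨Finset.mem_univ _, part_erase_mem_deleteElem ha Q⟩
  · exact fun _ _ => Finset.mem_univ _
  · exact fun Q _ => adjoin_deleteElem ha Q
  · rintro ⟨P, p⟩ hx
    simp only [deleteElem_adjoin, part_adjoin_erase]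
  · intro Q _
    rw [← card_parts_adjoin ha _ _ (part_erase_mem_deleteElem ha Q), adjoin_deleteElem]

end Finpartition

open Equiv in
lemma card_involutions {α : Type*} [Fintype α] :
    Nat.card {σ : Perm α // σ * σ = 1} = numInvolutions (Fintype.card α) := by
  refine Nat.card_congr ((Fintype.equivFin α).permCongrHom.toEquiv.subtypeEquiv fun σ => ?_)
  exact (map_eq_one_iff (Fintype.equivFin α).permCongrHom (MulEquiv.injective _)).symm.trans
    (by rw [map_mul]; rfl)

open Equiv in
lemma card_involutions_apply_eq {α : Type*} [Fintype α] [DecidableEq α] (a : α) :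
    Nat.card {σ : Perm α // σ * σ = 1 ∧ σ a = a} = numInvolutions (Fintype.card α - 1) := by
  have h : Fintype.card {x // x ≠ a} = Fintype.card α - 1 := by simp
  rw [← h, ← card_involutions]
  refine Nat.card_congr (Equiv.symm ?_)
  refine ((Perm.subtypeEquivSubtypePerm (· ≠ a)).subtypeEquiv
    (q := fun σ => σ.1 * σ.1 = 1) fun σ => ?_).trans ((Equiv.subtypeSubtypeEquivSubtypeInter
      (fun σ : Perm α => ∀ x, ¬ (x ≠ a) → σ x = x) (fun σ => σ * σ = 1)).trans
        (Equiv.subtypeEquivRight fun σ => ?_))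
  · rw [Perm.subtypeEquivSubtypePerm_apply_coe, ← map_mul,
      map_eq_one_iff _ Perm.ofSubtype_injective]
  · simp [and_comm]

open Equiv in
lemma swap_none_mul_optionCongr_involutive {α : Type*} [DecidableEq α] (a : α) (σ : Perm α) :
    (swap none (some a) * optionCongr σ) * (swap none (some a) * optionCongr σ) = 1
      ↔ σ * σ = 1 ∧ σ a = a := by
  constructor
  · intro h
    have h' : ∀ x, swap none (some a) (optionCongr σ (swap none (some a) (optionCongr σ x))) = x :=
      fun x => by simpa using Equiv.congr_fun h x
    have ha : σ a = a := by
      have := h' none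
      simp only [optionCongr_apply, Option.map_none, swap_apply_left, Option.map_some] at this
      by_contra hne
      rw [swap_apply_of_ne_of_ne (by simp) (by simpa using hne)] at this
      simp at this
    refine ⟨?_, ha⟩
    ext x
    by_cases hx : x = a
    · simp [hx, ha]
    have hσ : σ x ≠ a := fun h => hx (σ.injective (h.trans ha.symm))
    have hσσ : σ (σ x) ≠ a := fun h => hσ (σ.injective (h.trans ha.symm))
    have := h' (some x)
    simp only [optionCongr_apply, Option.map_some] at this
    rw [swap_apply_of_ne_of_ne (Option.some_ne_none _) (by simpa using hσ), Option.map_some,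
      swap_apply_of_ne_of_ne (Option.some_ne_none _) (by simpa using hσσ)] at this
    simpa using this
  · rintro ⟨h, ha⟩
    have hc : swap none (some a) * optionCongr σ = optionCongr σ * swap none (some a) := by
      rw [mul_swap_eq_swap_mul]
      simp [ha]
    rw [mul_assoc, ← mul_assoc (optionCongr σ), ← hc, mul_assoc, ← mul_assoc, swap_mul_self,
      one_mul]
    ext1 x
    cases x with
    | none => simp
    | some x => simpa using Equiv.congr_fun h x

open Equiv in
lemma numInvolutions_succ (n : ℕ) :
    numInvolutions (n + 1) = numInvolutions n + n * numInvolutions (n - 1) := by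
  classical
  have h1 : numInvolutions (n + 1) = Nat.card {σ : Perm (Option (Fin n)) // σ * σ = 1} := by
    rw [card_involutions]; simp
  let P : Option (Fin n) → Perm (Fin n) → Prop
    | none, σ => σ * σ = 1
    | some a, σ => σ * σ = 1 ∧ σ a = a
  have e : {σ : Perm (Option (Fin n)) // σ * σ = 1} ≃ Σ x, {σ // P x σ} :=
    (Perm.decomposeOption.symm.subtypeEquiv (p := fun x => P x.1 x.2) (by
      rintro ⟨_ | a, σ⟩
      · simp only [P, Perm.decomposeOption_symm_apply, swap_self]
        constructor
        · intro h
          ext1 x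
          cases x with
          | none => simp
          | some x => simpa using Equiv.congr_fun h x
        · intro h
          ext1 x
          simpa using Equiv.congr_fun h (some x)
      · exact (swap_none_mul_optionCongr_involutive a σ).symm)).symm.trans
      { toFun := fun x => ⟨x.1.1, x.1.2, x.2⟩
        invFun := fun x => ⟨(x.1, x.2.1), x.2.2⟩
        left_inv := fun _ => rfl
        right_inv := fun _ => rfl }
  rw [h1, Nat.card_congr e, Nat.card_sigma, Fintype.sum_option]
  congr 1
  simp only [P, card_involutions_apply_eq]
  simp

namespace LimitingVacillatingTableau

open YoungDiagram

@[ext]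
lemma ext_of_lam_of_mu {k : ℕ} {t t' : LimitingVacillatingTableau k} (hl : t.lam = t'.lam)
    (hm : t.mu = t'.mu) : t = t' := by
  cases t; cases t'; simp_all

/-- The last diagram of a limiting vacillating tableau. -/
def last {k : ℕ} (t : LimitingVacillatingTableau k) : YoungDiagram := t.lam (Fin.last k)

/-- The pairs of diagrams reachable from `l` by a half step followed by a full step. -/
noncomputable def steps (l : YoungDiagram) : Finset (Σ _ : YoungDiagram, YoungDiagram) :=
  (Finset.cons l l.down fun h => by simpa using (mem_down.1 h).2).sigma up

lemma mem_steps {l : YoungDiagram} {x : Σ _ : YoungDiagram, YoungDiagram} :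
    x ∈ steps l ↔ (x.1 = l ∨ (x.1 ≤ l ∧ l.card = x.1.card + 1)) ∧
      (x.1 ≤ x.2 ∧ x.2.card = x.1.card + 1) := by
  simp [steps, mem_down, mem_up]

lemma sum_steps (f : YoungDiagram → ℕ) (l : YoungDiagram) :
    ∑ x : steps l, f x.1.2 = (upSum f + downSum (upSum f)) l := by
  rw [Finset.sum_coe_sort (steps l) (fun x => f x.2), steps, Finset.sum_sigma, Finset.sum_cons]
  rfl

lemma sigma_steps_ext {k : ℕ} {x y : Σ t : LimitingVacillatingTableau k, steps t.last}
    (h₁ : x.1 = y.1) (h₂ : x.2.1 = y.2.1) : x = y := by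
  obtain ⟨t, x⟩ := x
  obtain ⟨t', y⟩ := y
  obtain rfl : t = t' := h₁
  exact congrArg _ (Subtype.ext h₂)

/-- A limiting vacillating tableau is built by appending a half step and a full step. -/
def equivSteps (k : ℕ) :
    LimitingVacillatingTableau (k + 1) ≃ Σ t : LimitingVacillatingTableau k, steps t.last where
  toFun t :=
    ⟨{  lam := fun j => t.lam j.castSucc
        mu := fun j => t.mu j.castSucc
        init := t.init
        half_step := fun j => t.half_step j.castSucc
        full_step := fun j => t.full_step j.castSucc },
      ⟨⟨t.mu (Fin.last k), t.lam (Fin.last (k + 1))⟩,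
        mem_steps.2 ⟨t.half_step (Fin.last k), t.full_step (Fin.last k)⟩⟩⟩
  invFun x :=
    { lam := Fin.snoc (α := fun _ => YoungDiagram) x.1.lam x.2.1.2
      mu := Fin.snoc (α := fun _ => YoungDiagram) x.1.mu x.2.1.1
      init := by
        rw [← Fin.castSucc_zero, Fin.snoc_castSucc]
        exact x.1.init
      half_step := by
        intro j
        rw [Fin.snoc_castSucc]
        refine Fin.lastCases ?_ (fun j => ?_) j
        · rw [Fin.snoc_last]
          exact (mem_steps.1 x.2.2).1
        · rw [Fin.snoc_castSucc]
          exact x.1.half_step j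
      full_step := by
        intro j
        refine Fin.lastCases ?_ (fun j => ?_) j
        · rw [Fin.snoc_last, Fin.succ_last, Fin.snoc_last]
          exact (mem_steps.1 x.2.2).2
        · rw [Fin.snoc_castSucc, Fin.succ_castSucc, Fin.snoc_castSucc]
          exact x.1.full_step j }
  left_inv t := by
    ext1
    · exact Fin.snoc_init_self (α := fun _ => YoungDiagram) t.lam
    · exact Fin.snoc_init_self (α := fun _ => YoungDiagram) t.mu
  right_inv := by
    intro x
    refine sigma_steps_ext ?_ ?_
    · ext1 <;> ext1 j <;> simp
    · simp

lemma last_equivSteps_symm {k : ℕ} (x : Σ t : LimitingVacillatingTableau k, steps t.last) :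
    ((equivSteps k).symm x).last = x.2.1.2 :=
  Fin.snoc_last (α := fun _ => YoungDiagram) _ _

instance : Unique (LimitingVacillatingTableau 0) where
  default := ⟨fun _ => ⊥, Fin.elim0, rfl, fun j => j.elim0, fun j => j.elim0⟩
  uniq t := by
    ext1
    · ext1 j
      rw [Fin.fin_one_eq_zero j, t.init]
    · exact Subsingleton.elim _ _

noncomputable instance instFintype : ∀ k, Fintype (LimitingVacillatingTableau k)
  | 0 => inferInstance
  | k + 1 =>
    haveI := instFintype k
    Fintype.ofEquiv _ (equivSteps k).symm

lemma sum_last_succ (k : ℕ) (f : YoungDiagram → ℕ) :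
    ∑ t : LimitingVacillatingTableau (k + 1), f t.last
      = ∑ t : LimitingVacillatingTableau k, (upSum f + downSum (upSum f)) t.last := by
  rw [← (equivSteps k).symm.sum_comp, Fintype.sum_sigma]
  simp_rw [last_equivSteps_symm, sum_steps]

lemma sum_last (k : ℕ) (f : YoungDiagram → ℕ) :
    ∑ t : LimitingVacillatingTableau k, f t.last
      = ∑ P : Finpartition (Finset.Icc 1 k), (upSum ^ P.parts.card) f ⊥ := by
  induction k generalizing f with
  | zero =>
    rw [Fintype.sum_unique, Finset.Icc_eq_empty_of_lt zero_lt_one, ← Finset.bot_eq_empty,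
      Fintype.sum_unique]
    rfl
  | succ k ih =>
    rw [sum_last_succ, ih, ← Finset.insert_Icc_right_eq_Icc_add_one (by omega : 1 ≤ k + 1),
      Finpartition.sum_card_parts_insert (by simp) fun n => (upSum ^ n) f ⊥]
    refine Finset.sum_congr rfl fun P _ => ?_
    rw [map_add, Pi.add_apply, upSum_pow_downSum_upSum_bot, pow_succ, Module.End.mul_apply]

end LimitingVacillatingTableau

lemma upSum_pow_one_bot (n : ℕ) :
    (YoungDiagram.upSum ^ n) 1 ⊥ = numInvolutions n := by
  induction n using Nat.twoStepInduction with
  | zero => simp [numInvolutions]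
  | one =>
    simp [YoungDiagram.upSum_one, YoungDiagram.downSum_bot, numInvolutions_succ 0]
    simp [numInvolutions]
  | more n h0 h1 =>
    rw [YoungDiagram.upSum_pow_one_bot_add_two, h0, h1, numInvolutions_succ (n + 1)]
    rfl

theorem card_limitingVacillatingTableau_eq_sum_stirling_mul_involutions
    (k : ℕ) (hk : 0 < k) :
    Nat.card (LimitingVacillatingTableau k)
      = ∑ j ∈ Finset.Icc 1 k, stirling k j * numInvolutions j := by
  have hmaps : ∀ P ∈ (Finset.univ : Finset (Finpartition (Finset.Icc 1 k))),
      P.parts.card ∈ Finset.Icc 1 k := by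
    intro P _
    have h1 := P.card_parts_le_card
    have h2 : P.parts.Nonempty := P.parts_nonempty (by simpa using hk.ne')
    rw [Nat.card_Icc] at h1
    exact Finset.mem_Icc.2 ⟨h2.card_pos, by omega⟩
  calc
    Nat.card (LimitingVacillatingTableau k)
      = ∑ t : LimitingVacillatingTableau k, (1 : YoungDiagram → ℕ) t.last := by simp
    _ = ∑ P : Finpartition (Finset.Icc 1 k), numInvolutions P.parts.card := by
      simp_rw [LimitingVacillatingTableau.sum_last, upSum_pow_one_bot]
    _ = ∑ j ∈ Finset.Icc 1 k, stirling k j * numInvolutions j := by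
      rw [← Finset.sum_fiberwise_of_maps_to' hmaps]
      refine Finset.sum_congr rfl fun j _ => ?_
      rw [Finset.sum_const, smul_eq_mul, stirling, Nat.card_eq_fintype_card, Fintype.card_subtype]
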